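/- Let τ_h > 0, let G, q : [0, τ_h] → ℝ be continuous, let ω, A ∈ ℝ, and fix τ ∈ (0, τ_h). For μ ∈ (0,1] define I⁺(τ,μ) = (ω/(4πμ)) ∫_{τ}^{τ_h} (G(t) − A μ q(t)) exp(−(t−τ)/μ) dt and I⁻(τ,μ) = (ω/(4πμ)) ∫_{0}^{τ} (G(t) + A μ q(t)) exp(−(τ−t)/μ) dt. Then 2π ∫_0^1 μ (I⁻(τ,μ) − I⁺(τ,μ)) dμ = (ω/2) ∫_0^{τ_h} [ A q(t) E₃(|τ − t|) + sgn(τ − t) G(t) E₂(|τ − t|) ] dt, where Eₙ(x) = ∫_0^1 μ^{n−2} exp(−x/μ) dμ and sgn denotes the sign function. -/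

import Mathlib

open Set MeasureTheory

/-- The `n`-th order exponential integral function
`Eₙ(x) = ∫_0^1 μ^{n-2} exp(-x/μ) dμ`. -/
noncomputable def expInt (n : ℕ) (x : ℝ) : ℝ :=
  ∫ μ in (0:ℝ)..1, μ ^ ((n : ℤ) - 2) * Real.exp (-x / μ)

/-- The upward diffuse intensity
`I⁺(τ,μ) = (ω/(4πμ)) ∫_τ^{τ_h} (G(t) - A μ q(t)) exp(-(t-τ)/μ) dt`. -/
noncomputable def Iup (G q : ℝ → ℝ) (ω A τh τ μ : ℝ) : ℝ :=
  (ω / (4 * Real.pi * μ)) * ∫ t in τ..τh, (G t - A * μ * q t) * Real.exp (-(t - τ) / μ)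

/-- The downward diffuse intensity
`I⁻(τ,μ) = (ω/(4πμ)) ∫_0^τ (G(t) + A μ q(t)) exp(-(τ-t)/μ) dt`. -/
noncomputable def Idown (G q : ℝ → ℝ) (ω A τ μ : ℝ) : ℝ :=
  (ω / (4 * Real.pi * μ)) * ∫ t in (0:ℝ)..τ, (G t + A * μ * q t) * Real.exp (-(τ - t) / μ)

theorem Real.measurable_sign : Measurable Real.sign := by
  unfold Real.sign
  exact Measurable.ite measurableSet_Iio measurable_const
    (Measurable.ite measurableSet_Ioi measurable_const measurable_const)

theorem Real.abs_sign_le_one (x : ℝ) : |Real.sign x| ≤ 1 := by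
  rcases Real.sign_apply_eq x with h | h | h <;> simp [h]

/-- Attenuation over a nonnegative optical distance is at most one. -/
theorem exp_neg_abs_div_le_one (x : ℝ) {μ : ℝ} (hμ : 0 < μ) : Real.exp (-|x| / μ) ≤ 1 :=
  Real.exp_le_one_iff.mpr
    (div_nonpos_of_nonpos_of_nonneg (neg_nonpos.mpr (abs_nonneg x)) hμ.le)

theorem expInt_two (x : ℝ) : expInt 2 x = ∫ μ in Ioc (0:ℝ) 1, Real.exp (-x / μ) := by
  simp [expInt, intervalIntegral.integral_of_le]

theorem expInt_three (x : ℝ) : expInt 3 x = ∫ μ in Ioc (0:ℝ) 1, μ * Real.exp (-x / μ) := by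
  simp [expInt, intervalIntegral.integral_of_le, show (3:ℤ) - 2 = 1 by norm_num]

/-- The integrand of the angular and depth integrals defining the radiative flux. -/
noncomputable def fluxKernel (G q : ℝ → ℝ) (A τ μ t : ℝ) : ℝ :=
  q t * (A * (μ * Real.exp (-|τ - t| / μ))) +
    G t * (Real.sign (τ - t) * Real.exp (-|τ - t| / μ))

theorem norm_mul_exp_neg_abs_div_le (A x : ℝ) {μ : ℝ} (hμ : μ ∈ Ioc (0:ℝ) 1) :
    ‖A * (μ * Real.exp (-|x| / μ))‖ ≤ |A| := by
  rw [norm_mul, Real.norm_eq_abs, Real.norm_of_nonneg (mul_nonneg hμ.1.le (Real.exp_nonneg _))]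
  exact mul_le_of_le_one_right (abs_nonneg A)
    (mul_le_one₀ hμ.2 (Real.exp_nonneg _) (exp_neg_abs_div_le_one x hμ.1))

theorem norm_sign_mul_exp_neg_abs_div_le (x : ℝ) {μ : ℝ} (hμ : μ ∈ Ioc (0:ℝ) 1) :
    ‖Real.sign x * Real.exp (-|x| / μ)‖ ≤ 1 := by
  rw [norm_mul, Real.norm_eq_abs, Real.norm_of_nonneg (Real.exp_nonneg _)]
  exact mul_le_one₀ (Real.abs_sign_le_one x) (Real.exp_nonneg _) (exp_neg_abs_div_le_one x hμ.1)

theorem measurable_mul_exp_kernel (A τ : ℝ) :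
    Measurable fun p : ℝ × ℝ => A * (p.1 * Real.exp (-|τ - p.2| / p.1)) := by
  simp only [← Real.norm_eq_abs]
  fun_prop

theorem measurable_sign_mul_exp_kernel (τ : ℝ) :
    Measurable fun p : ℝ × ℝ => Real.sign (τ - p.2) * Real.exp (-|τ - p.2| / p.1) := by
  simp only [← Real.norm_eq_abs]
  have := Real.measurable_sign.comp
    (measurable_const.sub measurable_snd : Measurable fun p : ℝ × ℝ => τ - p.2)
  exact this.mul (by fun_prop)

theorem integrable_uncurry_fluxKernel {G q : ℝ → ℝ} {s : Set ℝ}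
    (hG : IntegrableOn G s) (hq : IntegrableOn q s) (A τ : ℝ) :
    Integrable (Function.uncurry (fluxKernel G q A τ))
      ((volume.restrict (Ioc (0:ℝ) 1)).prod (volume.restrict s)) := by
  have hmem : ∀ᵐ p : ℝ × ℝ ∂(volume.restrict (Ioc (0:ℝ) 1)).prod (volume.restrict s),
      p.1 ∈ Ioc (0:ℝ) 1 :=
    Measure.quasiMeasurePreserving_fst.ae (ae_restrict_mem measurableSet_Ioc)
  refine Integrable.add ?_ ?_
  · refine (Integrable.comp_snd hq _).mul_bdd (c := |A|)
      (measurable_mul_exp_kernel A τ).aestronglyMeasurable ?_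
    filter_upwards [hmem] with p hp using norm_mul_exp_neg_abs_div_le A _ hp
  · refine (Integrable.comp_snd hG _).mul_bdd (c := 1)
      (measurable_sign_mul_exp_kernel τ).aestronglyMeasurable ?_
    filter_upwards [hmem] with p hp using norm_sign_mul_exp_neg_abs_div_le _ hp

theorem integrableOn_fluxKernel {G q : ℝ → ℝ} {s : Set ℝ}
    (hG : IntegrableOn G s) (hq : IntegrableOn q s) (A τ : ℝ) {μ : ℝ} (hμ : μ ∈ Ioc (0:ℝ) 1) :
    IntegrableOn (fluxKernel G q A τ μ) s := by
  refine Integrable.add ?_ ?_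
  · exact hq.mul_bdd (c := |A|)
      ((measurable_mul_exp_kernel A τ).comp measurable_prodMk_left).aestronglyMeasurable
      (.of_forall fun t => norm_mul_exp_neg_abs_div_le A _ hμ)
  · exact hG.mul_bdd (c := 1)
      ((measurable_sign_mul_exp_kernel τ).comp measurable_prodMk_left).aestronglyMeasurable
      (.of_forall fun t => norm_sign_mul_exp_neg_abs_div_le _ hμ)

/-- Integrating the flux kernel over the direction cosine yields exponential integrals. -/
theorem integral_fluxKernel_direction (G q : ℝ → ℝ) (A τ t : ℝ) :
    ∫ μ in Ioc (0:ℝ) 1, fluxKernel G q A τ μ t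
      = A * q t * expInt 3 |τ - t| + Real.sign (τ - t) * G t * expInt 2 |τ - t| := by
  have h₁ : IntegrableOn (fun μ => A * (μ * Real.exp (-|τ - t| / μ))) (Ioc (0:ℝ) 1) :=
    Measure.integrableOn_of_bounded (M := |A|) (by simp)
      ((measurable_mul_exp_kernel A τ).comp measurable_prodMk_right).aestronglyMeasurable
      ((ae_restrict_mem measurableSet_Ioc).mono fun μ hμ => norm_mul_exp_neg_abs_div_le A _ hμ)
  have h₂ : IntegrableOn (fun μ => Real.sign (τ - t) * Real.exp (-|τ - t| / μ)) (Ioc (0:ℝ) 1) :=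
    Measure.integrableOn_of_bounded (M := 1) (by simp)
      ((measurable_sign_mul_exp_kernel τ).comp measurable_prodMk_right).aestronglyMeasurable
      ((ae_restrict_mem measurableSet_Ioc).mono fun μ hμ => norm_sign_mul_exp_neg_abs_div_le _ hμ)
  unfold fluxKernel
  rw [integral_add (h₁.const_mul _) (h₂.const_mul _), expInt_two, expInt_three]
  simp only [integral_const_mul]
  ring

/-- The weighted intensity difference as one integral over the full optical depth. -/
theorem mul_Idown_sub_Iup {G q : ℝ → ℝ} {τh τ : ℝ} (ω A : ℝ) (hτ : τ ∈ Ioo 0 τh)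
    (hG : IntegrableOn G (Ioc 0 τh)) (hq : IntegrableOn q (Ioc 0 τh))
    {μ : ℝ} (hμ : μ ∈ Ioc (0:ℝ) 1) :
    μ * (Idown G q ω A τ μ - Iup G q ω A τh τ μ)
      = ω / (4 * Real.pi) * ∫ t in Ioc 0 τh, fluxKernel G q A τ μ t := by
  have hint : IntervalIntegrable (fluxKernel G q A τ μ) volume 0 τh :=
    (intervalIntegrable_iff_integrableOn_Ioc_of_le (hτ.1.trans hτ.2).le).mpr
      (integrableOn_fluxKernel hG hq A τ hμ)
  have hmem : τ ∈ uIcc 0 τh := Icc_subset_uIcc ⟨hτ.1.le, hτ.2.le⟩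
  have hdown : ∫ t in (0:ℝ)..τ, (G t + A * μ * q t) * Real.exp (-(τ - t) / μ)
      = ∫ t in (0:ℝ)..τ, fluxKernel G q A τ μ t := by
    rw [intervalIntegral.integral_of_le hτ.1.le, intervalIntegral.integral_of_le hτ.1.le,
      integral_Ioc_eq_integral_Ioo, integral_Ioc_eq_integral_Ioo]
    refine setIntegral_congr_fun measurableSet_Ioo fun t ht => ?_
    have h : 0 < τ - t := sub_pos.mpr ht.2
    simp only [fluxKernel, abs_of_pos h, Real.sign_of_pos h]
    ring
  have hup : ∫ t in τ..τh, (G t - A * μ * q t) * Real.exp (-(t - τ) / μ)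
      = -∫ t in τ..τh, fluxKernel G q A τ μ t := by
    rw [← intervalIntegral.integral_neg, intervalIntegral.integral_of_le hτ.2.le,
      intervalIntegral.integral_of_le hτ.2.le]
    refine setIntegral_congr_fun measurableSet_Ioc fun t ht => ?_
    have h : τ - t < 0 := sub_neg.mpr ht.1
    simp only [fluxKernel, abs_of_neg h, Real.sign_of_neg h, neg_sub]
    ring
  rw [Idown, Iup, hdown, hup, ← intervalIntegral.integral_of_le (hτ.1.trans hτ.2).le,
    ← intervalIntegral.integral_add_adjacent_intervals
      (hint.mono_set (uIcc_subset_uIcc_left hmem)) (hint.mono_set (uIcc_subset_uIcc_right hmem))]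
  have := hμ.1.ne'
  field_simp
  ring

theorem stmt4 (τh : ℝ) (hτh : 0 < τh) (G q : ℝ → ℝ)
    (hG : ContinuousOn G (Icc 0 τh)) (hq : ContinuousOn q (Icc 0 τh))
    (ω A : ℝ) (τ : ℝ) (hτ : τ ∈ Ioo 0 τh) :
    2 * Real.pi * ∫ μ in (0:ℝ)..1, μ * (Idown G q ω A τ μ - Iup G q ω A τh τ μ)
      = (ω / 2) * ∫ t in (0:ℝ)..τh,
          (A * q t * expInt 3 |τ - t| + Real.sign (τ - t) * G t * expInt 2 |τ - t|) := by
  have hG' : IntegrableOn G (Ioc 0 τh) := hG.integrableOn_Icc.mono_set Ioc_subset_Icc_self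
  have hq' : IntegrableOn q (Ioc 0 τh) := hq.integrableOn_Icc.mono_set Ioc_subset_Icc_self
  rw [intervalIntegral.integral_of_le zero_le_one, intervalIntegral.integral_of_le hτh.le,
    setIntegral_congr_fun measurableSet_Ioc fun μ hμ => mul_Idown_sub_Iup ω A hτ hG' hq' hμ,
    integral_const_mul, integral_integral_swap (integrable_uncurry_fluxKernel hG' hq' A τ)]
  simp only [integral_fluxKernel_direction]
  field_simp
  ring
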